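/- For n = 4 and for n = 5, the kernel of the surjective ring homomorphism φ_n : ℤ⟨x,y⟩ → M_n(ℤ) determined by φ_n(x) = X and φ_n(y) = Y equals the two-sided ideal of ℤ⟨x,y⟩ generated by the four elements r_{1,n} = xⁿ − 1, r_{2,n} = (Σ_{i=0}^{n−1} x^{n−i} y x^i) − 1, s_0 = y² − y, and s_1 = y x y. In particular M_4(ℤ) ≅ ℤ⟨x,y⟩/(r_{1,4}, r_{2,4}, s_0, s_1) and M_5(ℤ) ≅ ℤ⟨x,y⟩/(r_{1,5}, r_{2,5}, s_0, s_1). -/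

import Mathlib

/-- The `n × n` cyclic permutation matrix `X = E₂₁ + E₃₂ + ⋯ + E_{n,n-1} + E_{1n}`,
with `X i j = 1` iff `i ≡ j + 1 (mod n)`. -/
def Xmat (n : ℕ) : Matrix (Fin n) (Fin n) ℤ :=
  Matrix.of fun i j => if (i : ℕ) = ((j : ℕ) + 1) % n then 1 else 0

/-- The matrix unit `Y = E₁₁`. -/
def Ymat (n : ℕ) : Matrix (Fin n) (Fin n) ℤ :=
  Matrix.of fun i j => if (i : ℕ) = 0 ∧ (j : ℕ) = 0 then 1 else 0

/-- The generator `x` of the free ring `ℤ⟨x,y⟩ = FreeAlgebra ℤ (Fin 2)`. -/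
noncomputable def fx : FreeAlgebra ℤ (Fin 2) := FreeAlgebra.ι ℤ 0

/-- The generator `y` of the free ring `ℤ⟨x,y⟩ = FreeAlgebra ℤ (Fin 2)`. -/
noncomputable def fy : FreeAlgebra ℤ (Fin 2) := FreeAlgebra.ι ℤ 1

/-- The ring homomorphism `φₙ : ℤ⟨x,y⟩ → Mₙ(ℤ)` sending `x ↦ X`, `y ↦ Y`. -/
noncomputable def phi (n : ℕ) : FreeAlgebra ℤ (Fin 2) →ₐ[ℤ] Matrix (Fin n) (Fin n) ℤ :=
  FreeAlgebra.lift ℤ ![Xmat n, Ymat n]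

/-- `r_{1,n} = xⁿ - 1`. -/
noncomputable def r1 (n : ℕ) : FreeAlgebra ℤ (Fin 2) := fx ^ n - 1

/-- `r_{2,n} = (Σ_{i=0}^{n-1} x^{n-i} y x^i) - 1`. -/
noncomputable def r2 (n : ℕ) : FreeAlgebra ℤ (Fin 2) :=
  (∑ i ∈ Finset.range n, fx ^ (n - i) * fy * fx ^ i) - 1

/-- `s₀ = y² - y`. -/
noncomputable def s0 : FreeAlgebra ℤ (Fin 2) := fy ^ 2 - fy

/-- `s_j = y x^j y`. -/
noncomputable def s (j : ℕ) : FreeAlgebra ℤ (Fin 2) := fy * fx ^ j * fy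

theorem phi_fx (n : ℕ) : phi n fx = Xmat n := by simp [phi, fx]

theorem phi_fy (n : ℕ) : phi n fy = Ymat n := by simp [phi, fy]

/-- Matrix units `xⁱ y xⁿ⁻ʲ` in a ring satisfying the defining relations multiply as expected. -/
theorem matrixUnit_mul {A : Type*} [Ring A] {n : ℕ} {x y : A} (hx : x ^ n = 1)
    (hy : y * y = y) (hs : ∀ j, 0 < j → j < n → y * x ^ j * y = 0) (i j k l : Fin n) :
    (x ^ (i : ℕ) * y * x ^ (n - (j : ℕ))) * (x ^ (k : ℕ) * y * x ^ (n - (l : ℕ))) =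
      if j = k then x ^ (i : ℕ) * y * x ^ (n - (l : ℕ)) else 0 := by
  have key : y * x ^ (n - (j : ℕ) + k) * y = if j = k then y else 0 := by
    rcases lt_trichotomy (j : ℕ) k with h | h | h
    · have e : n - (j : ℕ) + k = n + (k - j) := by omega
      rw [e, pow_add, hx, one_mul, hs _ (by omega) (by omega), if_neg (by rintro rfl; omega)]
    · have e : n - (j : ℕ) + k = n := by omega
      rw [e, hx, mul_one, hy, if_pos (Fin.ext h)]
    · rw [hs _ (by omega) (by omega), if_neg (by rintro rfl; omega)]
  calc _ = x ^ (i : ℕ) * (y * x ^ (n - (j : ℕ) + k) * y) * x ^ (n - (l : ℕ)) := by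
        simp only [pow_add, mul_assoc]
    _ = _ := by rw [key]; split_ifs <;> simp

/-- The ring homomorphism out of `Mₙ(ℤ)` attached to a solution of the defining relations. -/
def ofMatrix {A : Type*} [Ring A] {n : ℕ} {x y : A} (hx : x ^ n = 1)
    (hy : y * y = y) (hs : ∀ j, 0 < j → j < n → y * x ^ j * y = 0)
    (h1 : ∑ i : Fin n, x ^ (i : ℕ) * y * x ^ (n - (i : ℕ)) = 1) :
    Matrix (Fin n) (Fin n) ℤ →+* A where
  toFun M := ∑ i, ∑ j, M i j • (x ^ (i : ℕ) * y * x ^ (n - (j : ℕ)))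
  map_zero' := by simp
  map_add' M N := by simp [add_smul, Finset.sum_add_distrib]
  map_one' := by
    rw [← h1]
    simp [Matrix.one_apply, ite_smul]
  map_mul' M N := by
    simp only [Matrix.mul_apply, Finset.sum_smul, Finset.sum_mul]
    refine Finset.sum_congr rfl fun i _ => ?_
    rw [Finset.sum_comm]
    refine Finset.sum_congr rfl fun k _ => ?_
    refine Eq.symm ?_
    rw [Finset.mul_sum, Finset.sum_eq_single k]
    · rw [Finset.mul_sum]
      refine Finset.sum_congr rfl fun j _ => ?_
      rw [smul_mul_smul_comm, matrixUnit_mul hx hy hs, if_pos rfl]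
    · intro l _ hl
      rw [Finset.mul_sum]
      refine Finset.sum_eq_zero fun j _ => ?_
      rw [smul_mul_smul_comm, matrixUnit_mul hx hy hs, if_neg hl.symm, smul_zero]
    · simp

theorem ofMatrix_Ymat {A : Type*} [Ring A] {n : ℕ} [NeZero n] {x y : A} (hx : x ^ n = 1)
    (hy : y * y = y) (hs : ∀ j, 0 < j → j < n → y * x ^ j * y = 0)
    (h1 : ∑ i : Fin n, x ^ (i : ℕ) * y * x ^ (n - (i : ℕ)) = 1) :
    ofMatrix hx hy hs h1 (Ymat n) = y := by
  change ∑ i, ∑ j, Ymat n i j • _ = _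
  rw [Finset.sum_eq_single 0, Finset.sum_eq_single 0]
  · simp [Ymat, hx]
  · intro b _ hb
    simp [Ymat, hb]
  · simp
  · intro b _ hb
    simp [Ymat, hb]
  · simp

theorem ofMatrix_Xmat {A : Type*} [Ring A] {n : ℕ} {x y : A} (hx : x ^ n = 1)
    (hy : y * y = y) (hs : ∀ j, 0 < j → j < n → y * x ^ j * y = 0)
    (h1 : ∑ i : Fin n, x ^ (i : ℕ) * y * x ^ (n - (i : ℕ)) = 1) :
    ofMatrix hx hy hs h1 (Xmat n) = x := by
  change ∑ i, ∑ j, Xmat n i j • _ = _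
  rw [Finset.sum_comm]
  conv_rhs => rw [← mul_one x, ← h1, Finset.mul_sum]
  refine Finset.sum_congr rfl fun j _ => ?_
  have hn : 0 < n := j.pos
  rw [Finset.sum_eq_single ⟨((j : ℕ) + 1) % n, Nat.mod_lt _ hn⟩]
  · simp only [Xmat, Matrix.of_apply, if_true, one_smul]
    rw [← pow_eq_pow_mod _ hx, pow_succ', mul_assoc, mul_assoc, mul_assoc]
  · intro b _ hb
    simp [Xmat, Fin.ext_iff] at hb ⊢
    simp [hb]
  · simp

/-- A ring homomorphism that kills `r₁`, `r₂`, `s₀` and all `s_j` with `0 < j < n` kills the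
kernel of `φₙ`. -/
theorem map_eq_zero_of_phi_eq_zero {n : ℕ} [NeZero n] {A : Type*} [Ring A] (q : FreeAlgebra ℤ (Fin 2) →+* A)
    (hx : q fx ^ n = 1) (hy : q fy * q fy = q fy)
    (hs : ∀ j, 0 < j → j < n → q fy * q fx ^ j * q fy = 0)
    (h1 : ∑ i : Fin n, q fx ^ (i : ℕ) * q fy * q fx ^ (n - (i : ℕ)) = 1)
    {f : FreeAlgebra ℤ (Fin 2)} (hf : phi n f = 0) : q f = 0 := by
  have h : ((ofMatrix hx hy hs h1).comp (phi n : _ →+* _)).toIntAlgHom = q.toIntAlgHom := by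
    refine FreeAlgebra.hom_ext (funext fun i => ?_)
    fin_cases i
    · change ofMatrix hx hy hs h1 (phi n fx) = q fx
      rw [phi_fx, ofMatrix_Xmat]
    · change ofMatrix hx hy hs h1 (phi n fy) = q fy
      rw [phi_fy, ofMatrix_Ymat]
  have hqf : ofMatrix hx hy hs h1 (phi n f) = q f := DFunLike.congr_fun h f
  rw [← hqf, hf, map_zero]

/-- In a ring satisfying `r₁`, `r₂` and `s₀`, the elements `y x^j y` satisfy a convolution
identity. -/
theorem corner_convolution {A : Type*} [Ring A] {n : ℕ} {x y : A} (hx : x ^ n = 1)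
    (hy : y * y = y) (h2 : ∑ i ∈ Finset.range n, x ^ (n - i) * y * x ^ i = 1) (k : ℕ) :
    ∑ i ∈ Finset.range n, (y * x ^ (n - i) * y) * (y * x ^ ((i + k) % n) * y) =
      y * x ^ k * y := by
  calc _ = ∑ i ∈ Finset.range n, y * (x ^ (n - i) * y * x ^ i) * (x ^ k * y) := by
        refine Finset.sum_congr rfl fun i _ => ?_
        rw [← pow_eq_pow_mod _ hx, pow_add]
        have : y * x ^ (n - i) * y * (y * (x ^ i * x ^ k) * y) =
          y * x ^ (n - i) * (y * y) * (x ^ i * x ^ k * y) := by simp only [mul_assoc]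
        rw [this, hy]
        simp only [mul_assoc]
    _ = _ := by rw [← Finset.sum_mul, ← Finset.mul_sum, h2, mul_one, mul_assoc]

theorem corner_eq_zero_four {A : Type*} [Ring A] {x y : A} (hx : x ^ 4 = 1)
    (hy : y * y = y) (h2 : ∑ i ∈ Finset.range 4, x ^ (4 - i) * y * x ^ i = 1)
    (h1 : y * x * y = 0) (j : ℕ) (hj : 0 < j) (hj' : j < 4) : y * x ^ j * y = 0 := by
  have H := corner_convolution hx hy h2
  have hl : ∀ k, y * (y * x ^ k * y) = y * x ^ k * y := fun k => by
    simp only [← mul_assoc, hy]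
  have hr : ∀ k, (y * x ^ k * y) * y = y * x ^ k * y := fun k => by
    rw [mul_assoc, hy]
  have e3 := H 3
  have e2 := H 2
  simp only [Finset.sum_range_succ, Finset.sum_range_zero, Nat.reduceAdd, Nat.reduceMod,
    Nat.reduceSub, hx, mul_one, hy, pow_zero, pow_one, h1, hl, hr, zero_add, zero_mul, mul_zero,
    add_zero, add_eq_left, add_assoc] at e3 e2
  rw [e3, zero_mul, zero_add] at e2
  interval_cases j
  · rwa [pow_one]
  · exact e2
  · exact e3

theorem corner_eq_zero_five {A : Type*} [Ring A] {x y : A} (hx : x ^ 5 = 1)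
    (hy : y * y = y) (h2 : ∑ i ∈ Finset.range 5, x ^ (5 - i) * y * x ^ i = 1)
    (h1 : y * x * y = 0) (j : ℕ) (hj : 0 < j) (hj' : j < 5) : y * x ^ j * y = 0 := by
  have H := corner_convolution hx hy h2
  have hl : ∀ k, y * (y * x ^ k * y) = y * x ^ k * y := fun k => by
    simp only [← mul_assoc, hy]
  have hr : ∀ k, (y * x ^ k * y) * y = y * x ^ k * y := fun k => by
    rw [mul_assoc, hy]
  have e4 := H 4
  have e3 := H 3
  have e2 := H 2
  have e0 := H 0
  simp only [Finset.sum_range_succ, Finset.sum_range_zero, Nat.reduceAdd, Nat.reduceMod,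
    Nat.reduceSub, hx, mul_one, hy, pow_zero, pow_one, h1, hl, hr, zero_add, zero_mul, mul_zero,
    add_zero, add_eq_left, add_assoc] at e4 e3 e2 e0
  suffices h : ∀ b c d : A, c * b + b * c = 0 → d + b * b = 0 → d * d + c = 0 →
      d * c + (c * d + b) = 0 → b = 0 ∧ c = 0 ∧ d = 0 by
    obtain ⟨hb, hc, hd⟩ := h _ _ _ e0 e4 e3 e2
    interval_cases j
    · rwa [pow_one]
    · exact hb
    · exact hc
    · exact hd
  intro b c d e0 e4 e3 e2
  obtain rfl : d = -(b * b) := eq_neg_of_add_eq_zero_left e4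
  obtain rfl : c = -(b * b * (b * b)) := by
    rw [eq_neg_of_add_eq_zero_right e3, neg_mul_neg]
  have hb : b = 0 := by
    have e : b = (-(b * b) * -(b * b * (b * b)) + (-(b * b * (b * b)) * -(b * b) + b)) +
        b * (-(b * b * (b * b)) * b + b * -(b * b * (b * b))) := by
      noncomm_ring
    rw [e, e2, e0]
    simp
  simp [hb]

theorem Xmat_pow_apply {n : ℕ} (k : ℕ) (i j : Fin n) :
    (Xmat n ^ k) i j = if (i : ℕ) = ((j : ℕ) + k) % n then 1 else 0 := by
  induction k generalizing j with
  | zero => simp [Matrix.one_apply, Fin.ext_iff, Nat.mod_eq_of_lt j.2]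
  | succ k ih =>
    rw [pow_succ, Matrix.mul_apply,
      Finset.sum_eq_single ⟨((j : ℕ) + 1) % n, Nat.mod_lt _ j.pos⟩]
    · rw [ih]
      simp [Xmat, add_assoc, add_comm 1 k]
    · intro b _ hb
      simp [Xmat, Fin.ext_iff] at hb ⊢
      simp [hb]
    · simp

theorem Xmat_mul_Ymat_mul_Xmat_apply {n : ℕ} (a b : ℕ) (i j : Fin n) :
    (Xmat n ^ a * Ymat n * Xmat n ^ b) i j =
      if (i : ℕ) = a % n ∧ ((j : ℕ) + b) % n = 0 then 1 else 0 := by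
  have : NeZero n := ⟨i.pos.ne'⟩
  rw [Matrix.mul_apply, Finset.sum_eq_single 0, Matrix.mul_apply, Finset.sum_eq_single 0]
  · simp only [Xmat_pow_apply, Ymat, Matrix.of_apply, Fin.val_zero, zero_add, if_true, mul_one,
      ite_and, eq_comm (a := 0)]
    split_ifs <;> simp
  · intro c _ hc
    simp [Ymat, hc]
  · simp
  · intro c _ hc
    rw [Matrix.mul_apply, Finset.sum_eq_zero, zero_mul]
    intro d _
    simp [Ymat, hc]
  · simp

theorem Xmat_mul_Ymat_mul_Xmat_eq_single {n : ℕ} (i j : Fin n) :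
    Xmat n ^ (i : ℕ) * Ymat n * Xmat n ^ (n - (j : ℕ)) = Matrix.single i j 1 := by
  ext k l
  have h : ((l : ℕ) + (n - j)) % n = 0 ↔ j = l := by
    rw [Fin.ext_iff]
    have hj := j.2
    have hl := l.2
    rcases le_or_gt (j : ℕ) l with h | h
    · have e : (l : ℕ) + (n - j) = (l - j) + n := by omega
      rw [e, Nat.add_mod_right, Nat.mod_eq_of_lt (by omega)]
      omega
    · rw [Nat.mod_eq_of_lt (by omega)]
      omega
  simp only [Xmat_mul_Ymat_mul_Xmat_apply, Matrix.single_apply, h, Nat.mod_eq_of_lt i.2,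
    ← Fin.ext_iff, eq_comm (a := k)]

theorem phi_surjective (n : ℕ) : Function.Surjective (phi n) := by
  intro M
  refine ⟨∑ i, ∑ j, M i j • (fx ^ (i : ℕ) * fy * fx ^ (n - (j : ℕ))), ?_⟩
  conv_rhs => rw [Matrix.matrix_eq_sum_single M]
  simp only [map_sum, map_zsmul, map_mul, map_pow, phi_fx, phi_fy,
    Xmat_mul_Ymat_mul_Xmat_eq_single, Matrix.smul_single, smul_eq_mul, mul_one]

theorem sum_range_conj_eq_sum_fin {A : Type*} [Ring A] {n : ℕ} {x y : A} (hx : x ^ n = 1) :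
    ∑ i ∈ Finset.range n, x ^ (n - i) * y * x ^ i =
      ∑ i : Fin n, x ^ (i : ℕ) * y * x ^ (n - (i : ℕ)) := by
  rw [Fin.sum_univ_eq_sum_range (fun i => x ^ i * y * x ^ (n - i))]
  cases n with
  | zero => simp
  | succ m =>
    rw [Finset.sum_range_succ', Finset.sum_range_succ']
    congr 1
    · rw [← Finset.sum_range_reflect]
      refine Finset.sum_congr rfl fun i hi => ?_
      rw [Finset.mem_range] at hi
      have e₁ : m + 1 - (m - 1 - i + 1) = i + 1 := by omega
      have e₂ : m - 1 - i + 1 = m + 1 - (i + 1) := by omega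
      rw [e₁, e₂]
    · simp [hx]

theorem Xmat_pow_self (n : ℕ) : Xmat n ^ n = 1 := by
  ext i j
  simp [Xmat_pow_apply, Matrix.one_apply, Fin.ext_iff, Nat.mod_eq_of_lt j.2]

theorem Ymat_mul_self (n : ℕ) : Ymat n * Ymat n = Ymat n := by
  ext i j
  have : NeZero n := ⟨i.pos.ne'⟩
  rw [Matrix.mul_apply, Finset.sum_eq_single 0]
  · simp only [Ymat, Matrix.of_apply, Fin.val_zero, and_true, true_and]
    split_ifs <;> simp_all
  · intro b _ hb
    simp [Ymat, hb]
  · simp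

theorem Ymat_mul_Xmat_mul_Ymat {n : ℕ} (hn : 1 < n) : Ymat n * Xmat n * Ymat n = 0 := by
  ext i j
  have : NeZero n := ⟨i.pos.ne'⟩
  rw [Matrix.mul_apply, Finset.sum_eq_single 0, Matrix.mul_apply, Finset.sum_eq_single 0]
  · simp [Ymat, Xmat, Nat.mod_eq_of_lt hn]
  · intro b _ hb
    simp [Ymat, hb]
  · simp
  · intro b _ hb
    simp [Ymat, hb]
  · simp

theorem ker_phi_eq_span {n : ℕ} [NeZero n] (hn : 1 < n)
    (hs : ∀ {A : Type} [Ring A] {x y : A}, x ^ n = 1 → y * y = y →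
      ∑ i ∈ Finset.range n, x ^ (n - i) * y * x ^ i = 1 → y * x * y = 0 →
      ∀ j, 0 < j → j < n → y * x ^ j * y = 0) :
    TwoSidedIdeal.ker (phi n) = TwoSidedIdeal.span {r1 n, r2 n, s0, s 1} := by
  set I := TwoSidedIdeal.span {r1 n, r2 n, s0, s 1} with hI
  apply le_antisymm
  · have hq : ∀ f ∈ ({r1 n, r2 n, s0, s 1} : Set (FreeAlgebra ℤ (Fin 2))),
        I.ringCon.mk' f = 0 := fun f hf => by
      rw [← TwoSidedIdeal.mem_ker, TwoSidedIdeal.ker_ringCon_mk']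
      exact TwoSidedIdeal.subset_span hf
    have hx := hq (r1 n) (by simp)
    have h2 := hq (r2 n) (by simp)
    have hy := hq s0 (by simp)
    have h1 := hq (s 1) (by simp)
    simp only [r1, r2, s0, s, map_sub, map_sum, map_mul, map_pow, map_one, sub_eq_zero, pow_one,
      sq] at hx h2 hy h1
    have h2' : ∑ i : Fin n, I.ringCon.mk' fx ^ (i : ℕ) * I.ringCon.mk' fy *
        I.ringCon.mk' fx ^ (n - (i : ℕ)) = 1 := by
      rw [← sum_range_conj_eq_sum_fin hx, h2]
    intro f hf
    rw [TwoSidedIdeal.mem_ker] at hf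
    rw [← TwoSidedIdeal.ker_ringCon_mk' I, TwoSidedIdeal.mem_ker]
    exact map_eq_zero_of_phi_eq_zero _ hx hy (hs hx hy h2 h1) h2' hf
  · rw [TwoSidedIdeal.span_le]
    rintro f (rfl | rfl | rfl | rfl) <;> rw [SetLike.mem_coe, TwoSidedIdeal.mem_ker]
    · simp [r1, phi_fx, Xmat_pow_self]
    · simp only [r2, map_sub, map_sum, map_mul, map_pow, map_one, phi_fx, phi_fy]
      rw [sum_range_conj_eq_sum_fin (Xmat_pow_self n)]
      simp [Xmat_mul_Ymat_mul_Xmat_eq_single, Matrix.sum_single_one]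
    · simp [s0, phi_fy, sq, Ymat_mul_self]
    · simp [s, phi_fx, phi_fy, Ymat_mul_Xmat_mul_Ymat hn]

theorem stmt_13 :
    (Function.Surjective (phi 4) ∧
      TwoSidedIdeal.ker (phi 4) =
        TwoSidedIdeal.span {r1 4, r2 4, s0, s 1}) ∧
    (Function.Surjective (phi 5) ∧
      TwoSidedIdeal.ker (phi 5) =
        TwoSidedIdeal.span {r1 5, r2 5, s0, s 1}) := by
  exact ⟨⟨phi_surjective 4, ker_phi_eq_span (by norm_num) corner_eq_zero_four⟩,
    phi_surjective 5, ker_phi_eq_span (by norm_num) corner_eq_zero_five⟩
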